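/- arXiv:1111.0483 — 2 statements merged into one kernel-verified Lean document; each statement's English description precedes it below -/
import Mathlib

section
/- Let X be a finite set of even cardinality N, and let E be an exponential family on X with extended tangent space T of dimension dim T = N/2 (so E has dimension N/2 − 1). If sup_P inf_{Q∈E} D(P‖Q) = log 2, then there exists a partition of X into N/2 blocks, each of cardinality 2, such that E equals the set of all strictly positive probability distributions on X that are constant on each block of the partition. -/
open scoped BigOperators Classical

noncomputable section

variable {X : Type*}

/-- A probability distribution on a finite set `X`. -/
def IsProb [Fintype X] (P : X → ℝ) : Prop :=
  (∀ x, 0 ≤ P x) ∧ ∑ x, P x = 1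

/-- Information divergence `D(P‖Q)` with values in `EReal`, equal to `⊤` if the
support of `P` is not contained in the support of `Q`.  (The convention
`0 · log 0 = 0` holds automatically since `Real.log 0 = 0`.) -/
def KL [Fintype X] (P Q : X → ℝ) : EReal :=
  if ∀ x, Q x = 0 → P x = 0 then ((∑ x, P x * Real.log (P x / Q x) : ℝ) : EReal) else ⊤

/-- The exponential family with strictly positive reference measure `ν` and extended
tangent space `T` (a subspace of `ℝ^X` containing the constants): the set of strictly
positive probability distributions `P` with `log (P/ν) ∈ T`. -/
def expFam [Fintype X] (ν : X → ℝ) (T : Submodule ℝ (X → ℝ)) : Set (X → ℝ) :=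
  {P | (∀ x, 0 < P x) ∧ ∑ x, P x = 1 ∧ (fun x => Real.log (P x / ν x)) ∈ T}

/-- `sup_P inf_{Q ∈ E} D(P‖Q)`, supremum over all probability distributions `P`. -/
def maxDiv [Fintype X] (E : Set (X → ℝ)) : EReal :=
  ⨆ P ∈ {P : X → ℝ | IsProb P}, ⨅ Q ∈ E, KL P Q

/-- The orthogonal complement of `T` in `ℝ^X` w.r.t. the standard inner product
(the normal space of the exponential family with extended tangent space `T`). -/
def orthSpace [Fintype X] (T : Submodule ℝ (X → ℝ)) : Set (X → ℝ) :=
  {u | ∀ t ∈ T, ∑ x, u x * t x = 0}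

/-- A circuit vector of a set `N ⊆ ℝ^X`: a nonzero element whose support is minimal,
i.e. every `u ∈ N` with `supp u ⊆ supp v` is a scalar multiple of `v`. -/
def IsCircuitVector (N : Set (X → ℝ)) (v : X → ℝ) : Prop :=
  v ∈ N ∧ v ≠ 0 ∧ ∀ u ∈ N, Function.support u ⊆ Function.support v → ∃ α : ℝ, u = α • v

/-- A circuit of `N`: the support of a circuit vector. -/
def IsCircuit (N : Set (X → ℝ)) (σ : Set X) : Prop :=
  ∃ v, IsCircuitVector N v ∧ σ = Function.support v

/-- The closed partition model of the partition given by the equivalence relation `r`: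
all probability distributions constant on each block. -/
def partModel [Fintype X] (r : X → X → Prop) : Set (X → ℝ) :=
  {Q | IsProb Q ∧ ∀ x y, r x y → Q x = Q y}

/-- The partition exponential family of the partition given by the equivalence
relation `r`: all strictly positive probability distributions constant on each block. -/
def partExpFam [Fintype X] (r : X → X → Prop) : Set (X → ℝ) :=
  {P | (∀ x, 0 < P x) ∧ ∑ x, P x = 1 ∧ ∀ x y, r x y → P x = P y}

/-- The set `X̲` of points not annihilated by all of `N`. -/
def underlineSet (N : Set (X → ℝ)) : Set X := {x | ∃ v ∈ N, v x ≠ 0}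

/-- The relation `x ∼ y` : every `v ∈ N` with `v x ≠ 0` has `v y ≠ 0`. -/
def coRel (N : Set (X → ℝ)) (x y : X) : Prop := ∀ v ∈ N, v x ≠ 0 → v y ≠ 0

/-- `Z` is an equivalence class of `∼` on `X̲`. -/
def IsClassOf (N : Set (X → ℝ)) (Z : Set X) : Prop :=
  ∃ x ∈ underlineSet N, Z = {y | coRel N x y}

end

theorem aux_F_le (X : Type*) [Fintype X]
    (ν : X → ℝ) (hν : ∀ x, 0 < ν x)
    (T : Submodule ℝ (X → ℝ)) (h1 : (fun _ => (1 : ℝ)) ∈ T)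
    (hmax : maxDiv (expFam ν T) ≤ ((Real.log 2 : ℝ) : EReal))
    (u : X → ℝ) (hu : u ∈ orthSpace T) (hs : ∑ x, max (u x) 0 = 1) :
    ∑ x, u x * (Real.log (u x) - Real.log (ν x)) ≤ 0 := by
  have hsum : ∑ x, u x = 0 := by simpa using hu _ h1
  have hneg : ∑ x, max (-u x) 0 = 1 := by
    have : ∑ x, (max (u x) 0 - max (-u x) 0) = ∑ x, u x := by
      refine Finset.sum_congr rfl fun x _ => ?_
      rcases le_total (u x) 0 with h | h
      · rw [max_eq_right h, max_eq_left (by linarith)]; ring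
      · rw [max_eq_left h, max_eq_right (by linarith)]; ring
    rw [Finset.sum_sub_distrib, hs, hsum] at this
    linarith
  have habs : ∑ x, |u x| = 2 := by
    have : ∑ x, (max (u x) 0 + max (-u x) 0) = ∑ x, |u x| := by
      refine Finset.sum_congr rfl fun x _ => ?_
      rcases le_total (u x) 0 with h | h
      · rw [max_eq_right h, max_eq_left (by linarith), abs_of_nonpos h]; ring
      · rw [max_eq_left h, max_eq_right (by linarith), abs_of_nonneg h]; ring
    rw [Finset.sum_add_distrib, hs, hneg] at this
    linarith
  refine le_of_forall_pos_le_add fun ε hε => ?_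
  have hP : IsProb (fun x => max (u x) 0) := ⟨fun x => le_max_right _ _, hs⟩
  have h2 : (⨅ Q ∈ expFam ν T, KL (fun x => max (u x) 0) Q) ≤ ((Real.log 2 : ℝ) : EReal) :=
    le_trans (le_iSup₂ (f := fun P (_ : P ∈ {P : X → ℝ | IsProb P}) =>
      ⨅ Q ∈ expFam ν T, KL P Q) (fun x => max (u x) 0) hP) hmax
  have h3 : (⨅ Q ∈ expFam ν T, KL (fun x => max (u x) 0) Q)
      < ((Real.log 2 + ε / 2 : ℝ) : EReal) :=
    lt_of_le_of_lt h2 (EReal.coe_lt_coe_iff.2 (by linarith))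
  simp only [iInf_lt_iff] at h3
  obtain ⟨Q, ⟨hQ0, hQ1, hQT⟩, hQ⟩ := h3
  rw [KL, if_pos (fun x hx => absurd hx (hQ0 x).ne'), EReal.coe_lt_coe_iff] at hQ
  have hor : ∑ x, u x * Real.log (Q x / ν x) = 0 := hu _ hQT
  have key : ∑ x, (u x * (Real.log (u x) - Real.log (ν x)) - u x * Real.log (Q x / ν x)
      + (|u x| * Real.log 2 + |u x| - 2 * Q x))
      ≤ ∑ x, 2 * (max (u x) 0 * Real.log (max (u x) 0 / Q x)) := by
    refine Finset.sum_le_sum fun x _ => ?_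
    have q := hQ0 x
    rw [Real.log_div q.ne' (hν x).ne']
    have hl : ∀ a : ℝ, 0 < a → a * Real.log 2 + a - 2 * Q x ≤ a * (Real.log a - Real.log (Q x)) := by
      intro a ha
      have := Real.log_le_sub_one_of_pos (x := 2 * Q x / a) (by positivity)
      rw [Real.log_div (by positivity) ha.ne', Real.log_mul (by norm_num) q.ne'] at this
      have h' := mul_le_mul_of_nonneg_left this ha.le
      have : a * (2 * Q x / a - 1) = 2 * Q x - a := by field_simp
      rw [this] at h'
      linarith
    rcases lt_trichotomy (u x) 0 with h | h | h
    · rw [max_eq_right h.le, abs_of_neg h]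
      have := hl (-u x) (by linarith)
      rw [Real.log_neg_eq_log] at this
      simp only [zero_mul, mul_zero]
      linarith
    · simp [h]; linarith
    · rw [max_eq_left h.le, abs_of_pos h, Real.log_div h.ne' q.ne']
      have := hl (u x) h
      linarith
  rw [← Finset.mul_sum, Finset.sum_add_distrib, Finset.sum_sub_distrib, Finset.sum_sub_distrib,
    Finset.sum_add_distrib, ← Finset.sum_mul, ← Finset.mul_sum, habs, hQ1, hor] at key
  linarith

theorem aux_F (X : Type*) [Fintype X]
    (ν : X → ℝ) (hν : ∀ x, 0 < ν x)
    (T : Submodule ℝ (X → ℝ)) (h1 : (fun _ => (1 : ℝ)) ∈ T)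
    (hmax : maxDiv (expFam ν T) ≤ ((Real.log 2 : ℝ) : EReal))
    (u : X → ℝ) (hu : u ∈ orthSpace T) :
    ∑ x, u x * (Real.log (u x) - Real.log (ν x)) = 0 := by
  have main : ∀ u ∈ orthSpace T, ∑ x, u x * (Real.log (u x) - Real.log (ν x)) ≤ 0 := by
    intro u hu
    have hsum : ∑ x, u x = 0 := by simpa using hu _ h1
    have hnn : 0 ≤ ∑ x, max (u x) 0 := Finset.sum_nonneg fun x _ => le_max_right _ _
    rcases hnn.eq_or_lt with h | h
    · have hz := (Finset.sum_eq_zero_iff_of_nonneg (fun x _ => le_max_right (u x) 0)).1 h.symm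
      have hle : ∀ x, u x ≤ 0 := fun x => max_eq_right_iff.1 (hz x (Finset.mem_univ x))
      have h0 := (Finset.sum_eq_zero_iff_of_nonpos (fun x _ => hle x)).1 hsum
      refine le_of_eq (Finset.sum_eq_zero fun x hx => ?_)
      rw [h0 x hx, zero_mul]
    · set s := ∑ x, max (u x) 0 with hs
      have h2 := aux_F_le X ν hν T h1 hmax (fun x => s⁻¹ * u x) ?_ ?_
      · have : ∑ x, s⁻¹ * u x * (Real.log (s⁻¹ * u x) - Real.log (ν x))
            = s⁻¹ * ∑ x, u x * (Real.log (u x) - Real.log (ν x))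
              - s⁻¹ * Real.log s * ∑ x, u x := by
          rw [Finset.mul_sum, Finset.mul_sum, ← Finset.sum_sub_distrib]
          refine Finset.sum_congr rfl fun x _ => ?_
          by_cases hx : u x = 0
          · simp [hx]
          · rw [Real.log_mul (by positivity) hx, Real.log_inv]; ring
        rw [this, hsum, mul_zero, sub_zero] at h2
        exact nonpos_of_mul_nonpos_right h2 (inv_pos.2 h)
      · intro t ht
        have := hu t ht
        simp only [mul_assoc, ← Finset.mul_sum, this, mul_zero]
      · have : ∀ x, max (s⁻¹ * u x) 0 = s⁻¹ * max (u x) 0 := by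
          intro x
          rw [mul_max_of_nonneg _ _ (inv_pos.2 h).le, mul_zero]
        simp only [this, ← Finset.mul_sum, ← hs]
        exact inv_mul_cancel₀ h.ne'
  refine le_antisymm (main u hu) ?_
  have := main (fun x => - u x) (by
    intro t ht
    have := hu t ht
    simp [this])
  simp only [Real.log_neg_eq_log, neg_mul, Finset.sum_neg_distrib] at this
  linarith

open Filter Topology in
theorem aux_deriv (X : Type*) [Fintype X] (ν u v : X → ℝ)
    (hF : ∀ t : ℝ, ∑ x, (u x + t * v x) * (Real.log (u x + t * v x) - Real.log (ν x)) = 0) :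
    ∑ x ∈ Finset.univ.filter (fun x => u x = 0), v x = 0 := by
  by_contra hC
  set C := ∑ x ∈ Finset.univ.filter (fun x => u x = 0), v x with hCdef
  set K := ∑ x ∈ Finset.univ.filter (fun x => u x = 0),
    v x * (Real.log (v x) - Real.log (ν x)) with hK
  set g : ℝ → ℝ := fun t => ∑ x ∈ Finset.univ.filter (fun x => ¬ u x = 0),
    (u x + t * v x) * (Real.log (u x + t * v x) - Real.log (ν x)) with hg
  have hd : DifferentiableAt ℝ g 0 := by
    refine DifferentiableAt.fun_sum fun x hx => ?_
    have hx' : u x + 0 * v x ≠ 0 := by simpa using hx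
    fun_prop (disch := assumption)
  have hgt : ∀ t, t ≠ 0 → g t = - (t * (C * Real.log t + K)) := by
    intro t ht
    have h := hF t
    rw [← Finset.sum_filter_add_sum_filter_not _ (fun x => u x = 0)] at h
    have : ∑ x ∈ Finset.univ.filter (fun x => u x = 0),
        (u x + t * v x) * (Real.log (u x + t * v x) - Real.log (ν x))
        = t * (C * Real.log t + K) := by
      rw [hCdef, hK, Finset.sum_mul, ← Finset.sum_add_distrib, Finset.mul_sum]
      refine Finset.sum_congr rfl fun x hx => ?_
      rw [(Finset.mem_filter.1 hx).2, zero_add]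
      by_cases hv : v x = 0
      · simp [hv]
      · rw [Real.log_mul ht hv]; ring
    rw [this] at h
    simp only [hg]
    linarith
  have hg0 : g 0 = 0 := by
    have h := hF 0
    rw [← Finset.sum_filter_add_sum_filter_not _ (fun x => u x = 0)] at h
    rw [Finset.sum_eq_zero, zero_add] at h
    · exact h
    · intro x hx
      rw [(Finset.mem_filter.1 hx).2]; simp
  have ht := hd.hasDerivAt.tendsto_slope
  have ht2 : Tendsto (fun t : ℝ => -(C * Real.log t + K)) (𝓝[≠] 0) (𝓝 (deriv g 0)) := by
    refine ht.congr' ?_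
    filter_upwards [self_mem_nhdsWithin] with t ht
    have ht : t ≠ 0 := ht
    rw [slope_def_field, hg0, hgt t ht]
    field_simp
    ring
  have ht3 : Tendsto Real.log (𝓝[≠] 0) (𝓝 ((-deriv g 0 - K) / C)) := by
    refine ((ht2.neg.sub_const K).div_const C).congr fun t => ?_
    field_simp
    ring
  exact not_tendsto_nhds_of_tendsto_atBot Real.tendsto_log_nhdsNE_zero _ ht3

/-- The normal space as a submodule. -/
theorem aux_orth (X : Type*) [Fintype X] (T : Submodule ℝ (X → ℝ)) :
    ∃ N : Submodule ℝ (X → ℝ), (∀ u, u ∈ N ↔ u ∈ orthSpace T) ∧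
      Module.finrank ℝ N = Fintype.card X - Module.finrank ℝ T ∧
      ∀ t, (∀ u ∈ N, ∑ x, u x * t x = 0) → t ∈ T := by
  let B : LinearMap.BilinForm ℝ (X → ℝ) := dotProductBilin ℝ ℝ
  have hBa : ∀ a b, B a b = ∑ x, a x * b x := fun a b => rfl
  have hrefl : B.IsRefl := by
    intro a b h
    rw [hBa] at h ⊢
    rw [← h]
    exact Finset.sum_congr rfl fun x _ => mul_comm _ _
  have hnd : B.Nondegenerate := by
    refine (LinearMap.IsRefl.nondegenerate_iff_separatingLeft hrefl).2 ?_
    intro a ha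
    exact dotProduct_eq_zero a ha
  refine ⟨B.orthogonal T, ?_, ?_, ?_⟩
  · intro u
    rw [LinearMap.BilinForm.mem_orthogonal_iff]
    refine forall₂_congr fun t _ => ?_
    rw [hBa]
    simp only [mul_comm]
  · rw [LinearMap.BilinForm.finrank_orthogonal hnd]; simp
  · intro t ht
    rw [← LinearMap.BilinForm.orthogonal_orthogonal hnd hrefl T,
      LinearMap.BilinForm.mem_orthogonal_iff]
    intro u hu
    exact ht u hu

theorem aux_class (X : Type*) [Fintype X] (N : Submodule ℝ (X → ℝ))
    (hZ : ∀ u ∈ N, ∀ v ∈ N, ∑ x ∈ Finset.univ.filter (fun x => u x = 0), v x = 0)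
    (x : X) (v : X → ℝ) (hv : v ∈ N) :
    ∑ y ∈ Finset.univ.filter (fun y => ∀ u ∈ N, (u x = 0 ↔ u y = 0)), v y = 0 := by
  let H : Submodule ℝ (X → ℝ) := N ⊓ LinearMap.ker (LinearMap.proj (R := ℝ) (φ := fun _ : X => ℝ) x)
  have hH : ∀ u, u ∈ H ↔ u ∈ N ∧ u x = 0 := by
    intro u; simp [H]
  obtain ⟨u, huH, hu⟩ := Module.Dual.exists_forall_mem_ne_zero_of_forall_exists H
    (fun i : {y : X // ∃ w ∈ H, w y ≠ 0} => LinearMap.proj (R := ℝ) (φ := fun _ : X => ℝ) i.1)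
    (fun i => i.2)
  refine (Finset.sum_subset ?_ ?_).trans (hZ u ((hH u).1 huH).1 v hv)
  · intro y hy
    simp only [Finset.mem_filter, Finset.mem_univ, true_and] at hy ⊢
    exact (hy u ((hH u).1 huH).1).1 ((hH u).1 huH).2
  · intro y hy hy2
    simp only [Finset.mem_filter, Finset.mem_univ, true_and] at hy hy2
    have hxy : ∀ w ∈ N, w x = 0 → w y = 0 := by
      intro w hw hwx
      by_contra hwy
      exact hu ⟨y, w, (hH w).2 ⟨hw, hwx⟩, hwy⟩ hy
    push Not at hy2
    obtain ⟨w, hw, hw2⟩ := hy2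
    have hwy : w y = 0 ∧ w x ≠ 0 := by
      rcases hw2 with h | h
      · exact absurd (hxy w hw h.1) h.2
      · exact ⟨h.2, h.1⟩
    have := hxy (v - (v x / w x) • w) (N.sub_mem hv (N.smul_mem _ hw)) (by
      simp [hwy.2])
    simpa [hwy.1] using this

/-- The setoid of parallel coordinates. -/
def auxSetoid {X : Type*} (N : Submodule ℝ (X → ℝ)) : Setoid X where
  r x y := ∀ u ∈ N, (u x = 0 ↔ u y = 0)
  iseqv := ⟨fun _ _ _ => Iff.rfl, fun h u hu => (h u hu).symm,
    fun h h' u hu => (h u hu).trans (h' u hu)⟩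

theorem aux_count (X : Type*) [Fintype X] (N : Submodule ℝ (X → ℝ)) (n : ℕ)
    (hX : Fintype.card X = n + n) (hN : Module.finrank ℝ N = n)
    (hcl : ∀ x, ∀ v ∈ N, ∑ y ∈ Finset.univ.filter (fun y => (auxSetoid N).r x y), v y = 0) :
    (∀ x, (Finset.univ.filter (fun y => (auxSetoid N).r x y)).card = 2) ∧
      Fintype.card (Quotient (auxSetoid N)) = n := by
  set A : Finset X := Finset.univ.filter (fun x => ∃ u ∈ N, u x ≠ 0) with hA
  set C : Finset (Quotient (auxSetoid N)) := A.image (Quotient.mk _) with hC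
  have hmk : ∀ x y, (Quotient.mk (auxSetoid N) x = Quotient.mk _ y) ↔ (auxSetoid N).r x y :=
    fun x y => Quotient.eq
  have hCn : n ≤ C.card := by
    let L : N →ₗ[ℝ] (C → ℝ) :=
      { toFun := fun v q => v.1 (Quotient.out q.1)
        map_add' := fun _ _ => rfl
        map_smul' := fun _ _ => rfl }
    have hL : Function.Injective L := by
      rw [injective_iff_map_eq_zero]
      intro v hv
      ext x
      show v.1 x = 0
      by_contra hx
      have hxA : x ∈ A := by
        rw [hA, Finset.mem_filter]
        exact ⟨Finset.mem_univ _, v.1, v.2, hx⟩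
      have h0 : v.1 (Quotient.out (Quotient.mk (auxSetoid N) x)) = 0 :=
        congrFun hv ⟨Quotient.mk _ x, Finset.mem_image_of_mem _ hxA⟩
      have hr := (hmk _ _).1 (Quotient.out_eq (Quotient.mk (auxSetoid N) x))
      exact hx ((hr v.1 v.2).1 h0)
    have := LinearMap.finrank_le_finrank_of_injective hL
    simpa [hN] using this
  have hfib : ∀ x ∈ A, A.filter (fun y => Quotient.mk (auxSetoid N) y = Quotient.mk _ x)
      = Finset.univ.filter (fun y => (auxSetoid N).r x y) := by
    intro x hx
    ext y
    simp only [hA, Finset.mem_filter, Finset.mem_univ, true_and] at hx ⊢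
    rw [hmk]
    constructor
    · rintro ⟨_, h⟩
      exact (auxSetoid N).symm h
    · intro h
      obtain ⟨u, hu, hux⟩ := hx
      exact ⟨⟨u, hu, fun h0 => hux ((h u hu).2 h0)⟩, (auxSetoid N).symm h⟩
  have h2 : ∀ x ∈ A, 2 ≤ (Finset.univ.filter (fun y => (auxSetoid N).r x y)).card := by
    intro x hx
    simp only [hA, Finset.mem_filter, Finset.mem_univ, true_and] at hx
    obtain ⟨u, hu, hux⟩ := hx
    have hmem : x ∈ Finset.univ.filter (fun y => (auxSetoid N).r x y) := by
      simpa using (auxSetoid N).refl x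
    by_contra hlt
    have h1 : (Finset.univ.filter (fun y => (auxSetoid N).r x y)).card ≤ 1 := by omega
    have heq : Finset.univ.filter (fun y => (auxSetoid N).r x y) = {x} :=
      Finset.eq_singleton_iff_unique_mem.2 ⟨hmem, fun y hy => Finset.card_le_one.1 h1 y hy x hmem⟩
    have := hcl x u hu
    rw [heq, Finset.sum_singleton] at this
    exact hux this
  have hsum : A.card = ∑ q ∈ C, (A.filter (fun y => Quotient.mk (auxSetoid N) y = q)).card :=
    Finset.card_eq_sum_card_image _ _
  have hfib2 : ∀ q ∈ C, 2 ≤ (A.filter (fun y => Quotient.mk (auxSetoid N) y = q)).card := by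
    intro q hq
    obtain ⟨x, hx, rfl⟩ := Finset.mem_image.1 hq
    rw [hfib x hx]
    exact h2 x hx
  have hge : ∑ q ∈ C, 2 ≤ ∑ q ∈ C, (A.filter (fun y => Quotient.mk (auxSetoid N) y = q)).card :=
    Finset.sum_le_sum hfib2
  have hconst : ∑ q ∈ C, 2 = C.card * 2 := by simp
  have hAle : A.card ≤ Fintype.card X := Finset.card_le_univ A
  have hAX : A = Finset.univ := by
    rw [← Finset.card_eq_iff_eq_univ]; omega
  have hCc : C.card = n := by omega
  have hall := (Finset.sum_eq_sum_iff_of_le hfib2).1 (by omega)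
  constructor
  · intro x
    have hx : x ∈ A := hAX ▸ Finset.mem_univ x
    rw [← hfib x hx]
    exact (hall _ (Finset.mem_image_of_mem _ hx)).symm
  · rw [← hCc, hC, hAX, Finset.image_univ_of_surjective Quotient.mk_surjective, Finset.card_univ]

/-- if `N` is even, `dim T = N/2` and `sup_P inf_{Q ∈ E} D(P‖Q) = log 2`,
then `E` is the partition exponential family of a partition into `N/2` blocks of
cardinality `2` (the partition being given by an equivalence relation `r`). -/
theorem stmt8 (X : Type*) [Fintype X] [Nonempty X]
    (ν : X → ℝ) (hν : ∀ x, 0 < ν x)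
    (T : Submodule ℝ (X → ℝ)) (h1 : (fun _ => (1 : ℝ)) ∈ T)
    (hNeven : Even (Fintype.card X))
    (hdim : Module.finrank ℝ T = Fintype.card X / 2)
    (hmax : maxDiv (expFam ν T) = ((Real.log 2 : ℝ) : EReal)) :
    ∃ r : X → X → Prop, Equivalence r ∧
      (∀ x : X, ({y | r x y} : Set X).ncard = 2) ∧
      (Set.range fun x : X => ({y | r x y} : Set X)).ncard = Fintype.card X / 2 ∧
      expFam ν T = partExpFam r := by

  obtain ⟨n, hn⟩ := hNeven
  have hn2 : Fintype.card X / 2 = n := by omega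
  rw [hn2] at hdim ⊢
  obtain ⟨N, hNmem, hNdim, hNT⟩ := aux_orth X T
  have hNdim' : Module.finrank ℝ N = n := by omega
  have hF := aux_F X ν hν T h1 hmax.le
  have hcl : ∀ x, ∀ v ∈ N,
      ∑ y ∈ Finset.univ.filter (fun y => (auxSetoid N).r x y), v y = 0 := by
    intro x v hv
    refine aux_class X N (fun u hu v hv => ?_) x v hv
    refine aux_deriv X ν u v fun t => ?_
    exact hF (u + t • v) ((hNmem _).1 (N.add_mem hu (N.smul_mem t hv)))
  obtain ⟨hc2, hcQ⟩ := aux_count X N n hn hNdim' hcl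
  have hmk : ∀ x y, (Quotient.mk (auxSetoid N) x = Quotient.mk _ y) ↔ (auxSetoid N).r x y :=
    fun x y => Quotient.eq
  -- T is the space of functions constant on the blocks
  have hT : LinearMap.range (LinearMap.funLeft ℝ ℝ (Quotient.mk (auxSetoid N))) = T := by
    refine Submodule.eq_of_le_of_finrank_eq ?_ ?_
    · rintro _ ⟨f, rfl⟩
      refine hNT _ fun u hu => ?_
      rw [← Finset.sum_fiberwise Finset.univ (Quotient.mk (auxSetoid N))]
      refine Finset.sum_eq_zero fun q _ => ?_
      obtain ⟨x, rfl⟩ := Quotient.mk_surjective q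
      have h := hcl x u hu
      have hfil : Finset.univ.filter (fun y => Quotient.mk (auxSetoid N) y = Quotient.mk _ x)
          = Finset.univ.filter (fun y => (auxSetoid N).r x y) := by
        ext y
        simp only [Finset.mem_filter, Finset.mem_univ, true_and]
        rw [hmk]
        exact ⟨fun h => (auxSetoid N).symm h, fun h => (auxSetoid N).symm h⟩
      calc _ = ∑ y ∈ Finset.univ.filter
              (fun y => Quotient.mk (auxSetoid N) y = Quotient.mk _ x),
              u y * f (Quotient.mk _ x) := by
            refine Finset.sum_congr rfl fun y hy => ?_
            rw [LinearMap.funLeft_apply, (Finset.mem_filter.1 hy).2]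
        _ = 0 := by rw [← Finset.sum_mul, hfil, h, zero_mul]
    · rw [LinearMap.finrank_range_of_inj
        (LinearMap.funLeft_injective_of_surjective _ _ _ Quotient.mk_surjective), hdim]
      simpa using hcQ
  have hTmem : ∀ t : X → ℝ, t ∈ T ↔ ∀ x y, (auxSetoid N).r x y → t x = t y := by
    intro t
    rw [← hT]
    constructor
    · rintro ⟨f, rfl⟩ x y h
      simp only [LinearMap.funLeft_apply]
      rw [(hmk x y).2 h]
    · intro h
      exact ⟨Quotient.lift t h, rfl⟩
  have hνr : ∀ x y, (auxSetoid N).r x y → ν x = ν y := by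
    intro x y hxy
    by_cases hne : x = y
    · rw [hne]
    have hs : ∀ t : X → ℝ, ∑ z, ((Pi.single x 1 - Pi.single y 1 : X → ℝ) z) * t z = t x - t y := by
      intro t
      simp [sub_mul, Finset.sum_sub_distrib, Pi.single_apply]
    have h := hF (Pi.single x 1 - Pi.single y 1) (by
      intro t ht
      rw [hs, (hTmem t).1 ht x y hxy, sub_self])
    have hlog : ∀ z, Real.log ((Pi.single x 1 - Pi.single y 1 : X → ℝ) z) = 0 := by
      intro z
      rw [Pi.sub_apply, Pi.single_apply, Pi.single_apply]
      split_ifs <;> simp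
    simp only [hlog, zero_sub] at h
    rw [hs (fun z => - Real.log (ν z))] at h
    exact Real.log_injOn_pos (hν x) (hν y) (by linarith)
  refine ⟨(auxSetoid N).r, (auxSetoid N).iseqv, ?_, ?_, ?_⟩
  · intro x
    rw [← hc2 x, ← Set.ncard_coe_finset]
    simp
  · have hfg : (fun x : X => ({y | (auxSetoid N).r x y} : Set X))
        = (fun q : Quotient (auxSetoid N) => {y : X | q = Quotient.mk _ y}) ∘ Quotient.mk _ := by
      funext x
      ext y
      exact (hmk x y).symm
    rw [hfg, Quotient.mk_surjective.range_comp, ← Set.image_univ, Set.ncard_image_of_injective,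
      Set.ncard_univ, Nat.card_eq_fintype_card, hcQ]
    intro p q hpq
    obtain ⟨x, rfl⟩ := Quotient.mk_surjective p
    have : x ∈ {y : X | q = Quotient.mk _ y} := by
      have hpq' : {y : X | Quotient.mk (auxSetoid N) x = Quotient.mk _ y}
        = {y : X | q = Quotient.mk _ y} := hpq
      rw [← hpq']
      rfl
    exact Eq.symm this
  · ext P
    simp only [expFam, partExpFam, Set.mem_setOf_eq]
    refine and_congr_right fun hP => and_congr_right fun _ => ?_
    rw [hTmem]
    refine forall₃_congr fun x y hxy => ?_
    rw [hνr x y hxy]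
    constructor
    · intro h
      have := Real.log_injOn_pos (div_pos (hP x) (hν y)) (div_pos (hP y) (hν y)) h
      exact (div_left_inj' (hν y).ne').1 this
    · intro h
      rw [h]
end

section
/- Let X be a finite set of cardinality N and let X' = {X¹, …, X^{N'}} be a partition of X of coarseness c < N such that |X¹| = l ≤ c and |X^i| = c for all i > 1. Let E be the partition exponential family of X', i.e. the set of strictly positive probability distributions on X constant on each block of X'. Then sup_P inf_{Q∈E} D(P‖Q) = log c, and every exponential family E' on X with E' ⊊ E (strict inclusion of subsets of the probability distributions) satisfies sup_P inf_{Q∈E'} D(P‖Q) > log c. -/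
open scoped BigOperators Classical

noncomputable section

/-- Key quantitative estimate. -/
lemma core_bound {ι : Type*} [Fintype ι] (p m n : ι → ℝ) (c k : ℝ) (hc : 0 < c)
    (hp : ∀ i, 0 ≤ p i) (hm : ∀ i, 0 ≤ m i) (hp1 : ∑ i, p i = 1) (hm1 : ∑ i, m i = 1)
    (hpm : ∀ i, p i = 0 ∨ m i = 0) (hn : ∀ i, 1 ≤ n i) (hpn : ∀ i, p i ≠ 0 → n i = c) :
    ∃ δ : ℝ, 0 < δ ∧ ∀ a : ι → ℝ, (∀ i, 0 < a i) → ∑ i, n i * a i = 1 →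
      ∑ i, (p i - m i) * Real.log (a i) = k →
      Real.log c + δ ≤ ∑ i, p i * Real.log (p i / a i) := by
  set H := ∑ i, p i * Real.log (p i) with hH
  refine ⟨min 1 (Real.exp (H - k - Real.log c - 1)), lt_min one_pos (Real.exp_pos _), ?_⟩
  intro a ha hna hk
  set δ := min 1 (Real.exp (H - k - Real.log c - 1)) with hδ
  have hδ0 : 0 < δ := lt_min one_pos (Real.exp_pos _)
  set θ := ∑ i, (if p i = 0 then n i * a i else 0) with hθ
  have hterm : ∀ i, 0 ≤ (if p i = 0 then n i * a i else 0) := by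
    intro i
    split_ifs
    · exact mul_nonneg (by linarith [hn i]) (ha i).le
    · exact le_rfl
  -- first bound
  have h1 : Real.log c + θ ≤ ∑ i, p i * Real.log (p i / a i) := by
    have e1 : Real.log c + θ = ∑ i, (p i * Real.log c + (p i - n i * a i)
        + (if p i = 0 then n i * a i else 0)) := by
      rw [Finset.sum_add_distrib, Finset.sum_add_distrib, ← Finset.sum_mul,
        Finset.sum_sub_distrib, hp1, hna]
      ring
    rw [e1]
    apply Finset.sum_le_sum
    intro i _
    by_cases h0 : p i = 0
    · simp [h0]
    · have hpi : 0 < p i := lt_of_le_of_ne (hp i) (Ne.symm h0)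
      rw [if_neg h0, hpn i h0]
      have hl := Real.log_le_sub_one_of_pos (show 0 < c * a i / p i by
        have := ha i; positivity)
      rw [Real.log_div (mul_pos hc (ha i)).ne' h0, Real.log_mul hc.ne' (ha i).ne'] at hl
      rw [Real.log_div h0 (ha i).ne']
      have h2 := mul_le_mul_of_nonneg_left hl (hp i)
      have h3 : p i * (c * a i / p i - 1) = c * a i - p i := by field_simp
      rw [h3] at h2
      linarith
  by_cases hcase : δ ≤ θ
  · linarith
  push Not at hcase
  have hle : ∀ i, m i ≠ 0 → a i ≤ θ := by
    intro i hi
    have hpi : p i = 0 := (hpm i).resolve_right hi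
    have h2 := Finset.single_le_sum (f := fun i => if p i = 0 then n i * a i else 0)
      (fun j _ => hterm j) (Finset.mem_univ i)
    simp only [hpi, if_true] at h2
    have := mul_le_mul_of_nonneg_right (hn i) (ha i).le
    linarith
  have h3 : ∑ i, m i * Real.log (a i) ≤ Real.log δ := by
    calc ∑ i, m i * Real.log (a i) ≤ ∑ i, m i * Real.log δ := by
          apply Finset.sum_le_sum
          intro i _
          by_cases h0 : m i = 0
          · simp [h0]
          · exact mul_le_mul_of_nonneg_left
              (Real.log_le_log (ha i) ((hle i h0).trans hcase.le)) (hm i)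
      _ = Real.log δ := by rw [← Finset.sum_mul, hm1, one_mul]
  have h4 : Real.log δ ≤ H - k - Real.log c - 1 := by
    rw [Real.log_le_iff_le_exp hδ0]
    exact min_le_right _ _
  have h5 : ∑ i, p i * Real.log (p i / a i) = H - k - ∑ i, m i * Real.log (a i) := by
    rw [← hk, hH, ← Finset.sum_sub_distrib, ← Finset.sum_sub_distrib]
    apply Finset.sum_congr rfl
    intro i _
    by_cases h0 : p i = 0
    · simp [h0]
    · rw [Real.log_div h0 (ha i).ne']; ring
  have h6 : δ ≤ 1 := min_le_left _ _
  linarith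

lemma KL_pos {X : Type*} [Fintype X] (P Q : X → ℝ) (hQ : ∀ x, 0 < Q x) :
    KL P Q = ((∑ x, P x * Real.log (P x / Q x) : ℝ) : EReal) := by
  unfold KL
  rw [if_pos]
  intro x hx
  exact absurd hx (hQ x).ne'

/-- the size of the block of `x` -/
def bsize {X : Type*} [Fintype X] (r : X → X → Prop) (x : X) : ℕ :=
  (Finset.univ.filter (fun y => r x y)).card

lemma bsize_eq {X : Type*} [Fintype X] (r : X → X → Prop) (x : X) :
    ({y | r x y} : Set X).ncard = bsize r x := by
  unfold bsize
  rw [← Set.ncard_coe_finset]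
  congr 1
  ext y
  simp

lemma part1_upper {X : Type*} [Fintype X] [Nonempty X]
    (r : X → X → Prop) (hr : Equivalence r) (c : ℕ)
    (hb : ∀ x, bsize r x ≤ c) (P : X → ℝ) (hP : IsProb P) :
    (⨅ Q ∈ partExpFam r, KL P Q) ≤ ((Real.log (c : ℝ) : ℝ) : EReal) := by
  have hbpos : ∀ x, 0 < bsize r x := fun x =>
    Finset.card_pos.mpr ⟨x, by simp [hr.refl x]⟩
  have hfilt : ∀ x y, r x y →
      Finset.univ.filter (fun z => r x z) = Finset.univ.filter (fun z => r y z) := by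
    intro x y hxy
    ext z
    simp only [Finset.mem_filter, Finset.mem_univ, true_and]
    exact ⟨fun h => hr.trans (hr.symm hxy) h, fun h => hr.trans hxy h⟩
  set A : X → ℝ := fun x => (∑ y ∈ Finset.univ.filter (fun z => r x z), P y) / bsize r x with hA
  have hAconst : ∀ x y, r x y → A x = A y := by
    intro x y hxy
    simp only [hA, bsize, hfilt x y hxy]
  have hA0 : ∀ x, 0 ≤ A x := fun x =>
    div_nonneg (Finset.sum_nonneg fun y _ => hP.1 y) (Nat.cast_nonneg _)
  have hAP : ∀ x, P x ≤ c * A x := by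
    intro x
    have h1 : P x ≤ ∑ y ∈ Finset.univ.filter (fun z => r x z), P y :=
      Finset.single_le_sum (fun y _ => hP.1 y) (by simp [hr.refl x])
    have hpos : (0 : ℝ) < bsize r x := by exact_mod_cast hbpos x
    have h2 : (bsize r x : ℝ) ≤ c := by exact_mod_cast hb x
    have h3 : (bsize r x : ℝ) * A x = ∑ y ∈ Finset.univ.filter (fun z => r x z), P y := by
      simp only [hA]; field_simp
    have := mul_le_mul_of_nonneg_right h2 (hA0 x)
    linarith
  have hA1 : ∑ x, A x = 1 := by
    have h1 : ∀ x, A x = ∑ y, if r x y then P y / bsize r y else 0 := by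
      intro x
      simp only [hA]
      rw [Finset.sum_div, Finset.sum_filter]
      apply Finset.sum_congr rfl
      intro y _
      split_ifs with h
      · simp only [bsize, hfilt x y h]
      · rfl
    simp_rw [h1]
    rw [Finset.sum_comm, ← hP.2]
    apply Finset.sum_congr rfl
    intro y _
    rw [← Finset.sum_filter, Finset.sum_const]
    have : Finset.univ.filter (fun x => r x y) = Finset.univ.filter (fun x => r y x) := by
      ext z; simp only [Finset.mem_filter, Finset.mem_univ, true_and]
      exact ⟨fun h => hr.symm h, fun h => hr.symm h⟩
    rw [this]
    have hpos : (0 : ℝ) < bsize r y := by exact_mod_cast hbpos y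
    change bsize r y • _ = _
    rw [nsmul_eq_mul]
    field_simp
  have hN : (0 : ℝ) < Fintype.card X := by exact_mod_cast Fintype.card_pos
  have hc : (0 : ℝ) < c := by
    obtain ⟨x⟩ := ‹Nonempty X›
    exact_mod_cast (hbpos x).trans_le (hb x)
  apply EReal.le_of_forall_lt_iff_le.mp
  intro z hz
  have hz' : Real.log c < z := by exact_mod_cast hz
  set ε := 1 - Real.exp (Real.log c - z) with hε
  have hlt1 : Real.exp (Real.log c - z) < 1 := by
    rw [Real.exp_lt_one_iff]; linarith
  have hε0 : 0 < ε := by linarith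
  have hε1 : 1 - ε = Real.exp (Real.log c - z) := by rw [hε]; ring
  have he0 := Real.exp_pos (Real.log c - z)
  set Q : X → ℝ := fun x => (1 - ε) * A x + ε / Fintype.card X with hQ
  have hQ0 : ∀ x, 0 < Q x := by
    intro x
    have h1 := mul_nonneg (show 0 ≤ 1 - ε by rw [hε1]; exact he0.le) (hA0 x)
    have : 0 < ε / Fintype.card X := by positivity
    simp only [hQ]
    linarith
  have hQE : Q ∈ partExpFam r := by
    refine ⟨hQ0, ?_, ?_⟩
    · simp only [hQ]
      rw [Finset.sum_add_distrib, ← Finset.mul_sum, hA1, Finset.sum_const, Finset.card_univ,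
        nsmul_eq_mul]
      field_simp
      ring
    · intro x y hxy
      simp only [hQ, hAconst x y hxy]
  refine (iInf₂_le Q hQE).trans ?_
  rw [KL_pos P Q hQ0]
  norm_cast
  calc ∑ x, P x * Real.log (P x / Q x) ≤ ∑ x, P x * z := by
        apply Finset.sum_le_sum
        intro x _
        by_cases h0 : P x = 0
        · simp [h0]
        have hpx : 0 < P x := lt_of_le_of_ne (hP.1 x) (Ne.symm h0)
        apply mul_le_mul_of_nonneg_left _ hpx.le
        rw [Real.log_le_iff_le_exp (div_pos hpx (hQ0 x)), div_le_iff₀ (hQ0 x)]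
        have h1 : Real.exp z * (1 - ε) = c := by
          rw [hε1, ← Real.exp_add]
          rw [show z + (Real.log c - z) = Real.log c by ring, Real.exp_log hc]
        have h2 : Real.exp z * Q x = c * A x + Real.exp z * (ε / Fintype.card X) := by
          simp only [hQ]; rw [← h1]; ring
        have : 0 < Real.exp z * (ε / Fintype.card X) := by positivity
        rw [h2]
        linarith [hAP x]
    _ = z := by rw [← Finset.sum_mul, hP.2, one_mul]

lemma part1_lower {X : Type*} [Fintype X]
    (r : X → X → Prop) (x : X) (hx : 0 < bsize r x) :
    ((Real.log (bsize r x : ℝ) : ℝ) : EReal) ≤ maxDiv (partExpFam r) := by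
  have hP : IsProb (Pi.single x (1 : ℝ)) := by
    refine ⟨fun y => ?_, by simp⟩
    by_cases h : y = x
    · subst h; simp
    · simp [h]
  refine le_trans ?_ (le_iSup₂ (f := fun P (_ : P ∈ {P : X → ℝ | IsProb P}) =>
    ⨅ Q ∈ partExpFam r, KL P Q) _ hP)
  refine le_iInf₂ fun Q hQ => ?_
  rw [KL_pos _ Q hQ.1]
  norm_cast
  rw [Finset.sum_eq_single x]
  · have hb : (0 : ℝ) < bsize r x := by exact_mod_cast hx
    have h1 : (bsize r x : ℝ) * Q x ≤ 1 := by
      rw [← hQ.2.1]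
      calc (bsize r x : ℝ) * Q x = ∑ y ∈ Finset.univ.filter (fun y => r x y), Q x := by
            rw [Finset.sum_const, nsmul_eq_mul]; rfl
        _ = ∑ y ∈ Finset.univ.filter (fun y => r x y), Q y := by
            apply Finset.sum_congr rfl
            intro y hy
            exact hQ.2.2 x y (by simpa using hy)
        _ ≤ ∑ y, Q y := Finset.sum_le_sum_of_subset_of_nonneg (Finset.subset_univ _)
            (fun y _ _ => (hQ.1 y).le)
    simp only [Pi.single_eq_same, one_mul]
    apply Real.log_le_log hb
    rwa [le_div_iff₀ (hQ.1 x)]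
  · intro y _ hy
    simp [hy]
  · simp

lemma part2 {X : Type*} [Fintype X] [Nonempty X]
    (s : Setoid X) (c : ℕ) (hc : 0 < c) (x₀ : X)
    (hother : ∀ x : X, ¬ s.r x₀ x → bsize s.r x = c)
    (ν : X → ℝ) (T : Submodule ℝ (X → ℝ)) (hν : ∀ x, 0 < ν x)
    (h1T : (fun _ => (1 : ℝ)) ∈ T) (hsub : expFam ν T ⊂ partExpFam s.r) :
    ((Real.log (c : ℝ) : ℝ) : EReal) < maxDiv (expFam ν T) := by
  have hνc : ∀ x y, s.r x y → ν x = ν y := by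
    have hZ : 0 < ∑ x, ν x := Finset.sum_pos (fun x _ => hν x) Finset.univ_nonempty
    have hmem : (fun x => ν x / ∑ x, ν x) ∈ expFam ν T := by
      refine ⟨fun x => div_pos (hν x) hZ, ?_, ?_⟩
      · rw [← Finset.sum_div, div_self hZ.ne']
      · convert T.smul_mem (Real.log (1 / ∑ x, ν x)) h1T using 1
        funext x
        simp only [Pi.smul_apply, smul_eq_mul, mul_one]
        congr 1
        have := (hν x).ne'
        field_simp
    intro x y hxy
    have := (hsub.1 hmem).2.2 x y hxy
    simp only at this
    field_simp at this
    exact this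
  -- pull back to quotient
  let L : (Quotient s → ℝ) →ₗ[ℝ] (X → ℝ) := LinearMap.funLeft ℝ ℝ (Quotient.mk s)
  have hL : ∀ g x, L g x = g (Quotient.mk s x) := fun g x => rfl
  have hout : ∀ x : X, s.r (Quotient.mk s x).out x := fun x => Quotient.mk_out x
  have hLf : ∀ f : X → ℝ, (∀ x y, s.r x y → f x = f y) →
      L (fun i => f i.out) = f := by
    intro f hf
    funext x
    rw [hL]
    exact hf _ _ (hout x)
  have hTne : T.comap L ≠ ⊤ := by
    intro htop
    apply hsub.2
    intro P hP
    refine ⟨hP.1, hP.2.1, ?_⟩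
    have h2 : (fun i : Quotient s => Real.log (P i.out / ν i.out)) ∈ T.comap L := by
      rw [htop]; trivial
    rw [Submodule.mem_comap] at h2
    rwa [hLf (fun x => Real.log (P x / ν x))
      (fun x y h => by simp only [hP.2.2 x y h, hνc x y h])] at h2
  obtain ⟨f, hf0, hfT⟩ := Submodule.exists_le_ker_of_lt_top _ (lt_top_iff_ne_top.mpr hTne)
  -- normal vector
  obtain ⟨u, hu0, huT, hux⟩ : ∃ u : Quotient s → ℝ, u ≠ 0 ∧
      (∀ g ∈ T.comap L, ∑ i, u i * g i = 0) ∧ u (Quotient.mk s x₀) ≤ 0 := by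
    have hfu : ∀ g : Quotient s → ℝ, f g = ∑ i, f (Pi.single i 1) * g i := by
      intro g
      conv_lhs => rw [pi_eq_sum_univ' g]
      rw [map_sum]
      apply Finset.sum_congr rfl
      intro i _
      rw [map_smul, smul_eq_mul, mul_comm]
    have hne : (fun i => f (Pi.single i 1)) ≠ 0 := by
      intro h
      apply hf0
      refine LinearMap.ext fun g => ?_
      have h2 : ∀ i, f (Pi.single i 1) = 0 := fun i => congrFun h i
      rw [hfu g, LinearMap.zero_apply]
      exact Finset.sum_eq_zero fun i _ => by rw [h2 i, zero_mul]
    by_cases hsgn : f (Pi.single (Quotient.mk s x₀) 1) ≤ 0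
    · refine ⟨fun i => f (Pi.single i 1), hne, ?_, hsgn⟩
      intro g hg
      rw [← hfu]
      exact hfT hg
    · refine ⟨fun i => - f (Pi.single i 1), ?_, ?_, by linarith⟩
      · intro h
        apply hne
        funext i
        have := congrFun h i
        simpa using this
      · intro g hg
        simp only [neg_mul, Finset.sum_neg_distrib]
        rw [← hfu, hfT hg, neg_zero]
  have husum : ∑ i, u i = 0 := by
    have := huT (fun _ => 1) (by
      rw [Submodule.mem_comap]
      exact h1T)
    simpa using this
  set S := ∑ i, max (u i) 0 with hS
  have hS' : ∑ i, max (- u i) 0 = S := by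
    have : ∑ i, (max (u i) 0 - max (- u i) 0) = ∑ i, u i := by
      apply Finset.sum_congr rfl
      intro i _
      rcases le_total (u i) 0 with h | h
      · rw [max_eq_right h, max_eq_left (by linarith)]; ring
      · rw [max_eq_left h, max_eq_right (by linarith)]; ring
    rw [Finset.sum_sub_distrib, husum] at this
    linarith
  have hSpos : 0 < S := by
    refine lt_of_le_of_ne (Finset.sum_nonneg fun i _ => le_max_right _ _) ?_
    intro h
    apply hu0
    have ha := (Finset.sum_eq_zero_iff_of_nonneg (s := Finset.univ)
      (f := fun i => max (u i) 0) (fun i _ => le_max_right _ _)).mp h.symm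
    have hb := (Finset.sum_eq_zero_iff_of_nonneg (s := Finset.univ)
      (f := fun i => max (-u i) 0) (fun i _ => le_max_right _ _)).mp (hS'.trans h.symm)
    funext i
    have h1 := ha i (Finset.mem_univ i)
    have h2 := hb i (Finset.mem_univ i)
    have h3 := le_max_left (u i) 0
    have h4 := le_max_left (-u i) 0
    simp only [Pi.zero_apply]
    linarith
  set p : Quotient s → ℝ := fun i => max (u i) 0 / S with hpdef
  set m : Quotient s → ℝ := fun i => max (- u i) 0 / S with hmdef
  have hpmu : ∀ i, p i - m i = u i / S := by
    intro i
    simp only [hpdef, hmdef]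
    rcases le_total (u i) 0 with h | h
    · rw [max_eq_right h, max_eq_left (by linarith)]; ring
    · rw [max_eq_left h, max_eq_right (by linarith)]; ring
  set n : Quotient s → ℝ := fun i => bsize s.r i.out with hn
  have hp0 : ∀ i, 0 ≤ p i := fun i => div_nonneg (le_max_right _ _) hSpos.le
  have hp1 : ∑ i, p i = 1 := by
    simp only [hpdef]
    rw [← Finset.sum_div, ← hS, div_self hSpos.ne']
  obtain ⟨δ, hδ, hcore⟩ := core_bound p m n c
    (∑ i, (p i - m i) * Real.log (ν i.out)) (by exact_mod_cast hc) hp0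
    (fun i => div_nonneg (le_max_right _ _) hSpos.le) hp1
    (by simp only [hmdef]; rw [← Finset.sum_div, hS', div_self hSpos.ne'])
    (by
      intro i
      simp only [hpdef, hmdef]
      rcases le_total (u i) 0 with h | h
      · left; rw [max_eq_right h, zero_div]
      · right; rw [max_eq_right (by linarith), zero_div])
    (by
      intro i
      simp only [hn]
      have : 0 < bsize s.r i.out := Finset.card_pos.mpr ⟨i.out, by simp [s.iseqv.refl]⟩
      exact_mod_cast this)
    (by
      intro i hi
      simp only [hn]
      rw [hother]
      intro hrel
      apply hi
      have : i = Quotient.mk s x₀ := by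
        rw [← Quotient.out_eq i]
        exact Quotient.sound (s.iseqv.symm hrel)
      simp only [hpdef]
      rw [this, max_eq_right hux, zero_div])
  -- summation over representatives
  set P : X → ℝ := fun x => if x = (Quotient.mk s x).out then p (Quotient.mk s x) else 0 with hPdef
  have hrep : ∀ F : X → ℝ, (∀ x, x ≠ (Quotient.mk s x).out → F x = 0) →
      ∑ x, F x = ∑ i : Quotient s, F i.out := by
    intro F hF
    rw [← Finset.sum_fiberwise Finset.univ (Quotient.mk s) F]
    apply Finset.sum_congr rfl
    intro i _
    rw [Finset.sum_eq_single i.out]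
    · intro x hx hne
      apply hF
      simp only [Finset.mem_filter, Finset.mem_univ, true_and] at hx
      rwa [hx]
    · intro h
      simp at h
  have hPout : ∀ i : Quotient s, P i.out = p i := by
    intro i
    simp [hPdef]
  have hP : IsProb P := by
    constructor
    · intro x
      simp only [hPdef]
      split_ifs
      · exact hp0 _
      · exact le_rfl
    · rw [hrep P (fun x hx => by simp only [hPdef]; rw [if_neg hx])]
      simp_rw [hPout]
      exact hp1
  refine lt_of_lt_of_le ?_ (le_iSup₂ (f := fun P (_ : P ∈ {P : X → ℝ | IsProb P}) =>
    ⨅ Q ∈ expFam ν T, KL P Q) P hP)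
  refine lt_of_lt_of_le (b := ((Real.log c + δ : ℝ) : EReal)) (by
    rw [EReal.coe_lt_coe_iff]; linarith) ?_
  refine le_iInf₂ fun Q hQ => ?_
  rw [KL_pos P Q hQ.1, EReal.coe_le_coe_iff]
  have hQE := hsub.1 hQ
  rw [hrep _ (fun x hx => by simp only [hPdef]; rw [if_neg hx, zero_mul])]
  simp_rw [hPout]
  apply hcore (fun i => Q i.out) (fun i => hQ.1 _)
  · rw [← hQ.2.1, ← Finset.sum_fiberwise Finset.univ (Quotient.mk s) Q]
    apply Finset.sum_congr rfl
    intro i _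
    have hfe : Finset.univ.filter (fun x => Quotient.mk s x = i)
        = Finset.univ.filter (fun y => s.r i.out y) := by
      ext y
      simp only [Finset.mem_filter, Finset.mem_univ, true_and]
      constructor
      · rintro rfl
        exact hout y
      · intro h
        rw [← Quotient.out_eq i]
        exact Quotient.sound (s.iseqv.symm h)
    rw [hfe]
    simp only [hn]
    rw [Finset.sum_congr rfl (g := fun _ => Q i.out), Finset.sum_const, nsmul_eq_mul]
    · rfl
    · intro y hy
      exact (hQE.2.2 _ _ (by simpa using hy)).symm
  · rw [← sub_eq_zero, ← Finset.sum_sub_distrib]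
    have h2 : (fun i : Quotient s => Real.log (Q i.out / ν i.out)) ∈ T.comap L := by
      rw [Submodule.mem_comap, hLf (fun x => Real.log (Q x / ν x))
        (fun x y h => by simp only [hQE.2.2 x y h, hνc x y h])]
      exact hQ.2.2
    have h3 := huT _ h2
    rw [← zero_div S, ← h3, Finset.sum_div]
    apply Finset.sum_congr rfl
    intro i _
    rw [hpmu, Real.log_div (hQ.1 _).ne' (hν _).ne']
    ring

end

/-- the partition exponential family of a partition of coarseness
`c < N` with one block of cardinality `l ≤ c` and all other blocks of cardinality `c`
is inclusion `log c`-optimal: its maximal divergence is `log c`, and every exponential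
family strictly contained in it has maximal divergence `> log c`. -/
theorem stmt17 (X : Type*) [Fintype X] [Nonempty X]
    (r : X → X → Prop) (hr : Equivalence r) (c l : ℕ)
    (hcN : c < Fintype.card X) (hlc : l ≤ c)
    (x₀ : X) (hx₀ : ({y | r x₀ y} : Set X).ncard = l)
    (hother : ∀ x : X, ¬ r x₀ x → ({y | r x y} : Set X).ncard = c) :
    maxDiv (partExpFam r) = ((Real.log (c : ℝ) : ℝ) : EReal) ∧
    ∀ (ν : X → ℝ) (T : Submodule ℝ (X → ℝ)),
      (∀ x, 0 < ν x) → (fun _ => (1 : ℝ)) ∈ T →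
      expFam ν T ⊂ partExpFam r →
      ((Real.log (c : ℝ) : ℝ) : EReal) < maxDiv (expFam ν T) := by
  simp only [bsize_eq] at hx₀ hother
  have hb : ∀ x, bsize r x ≤ c := by
    intro x
    by_cases h : r x₀ x
    · have : bsize r x = bsize r x₀ := by
        unfold bsize
        congr 1
        ext z
        simp only [Finset.mem_filter, Finset.mem_univ, true_and]
        exact ⟨fun h' => hr.trans h h', fun h' => hr.trans (hr.symm h) h'⟩
      omega
    · exact (hother x h).le
  have hbpos : ∀ x, 0 < bsize r x := fun x =>
    Finset.card_pos.mpr ⟨x, by simp [hr.refl x]⟩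
  obtain ⟨x₁, hx₁⟩ : ∃ x, ¬ r x₀ x := by
    by_contra! hall
    have : bsize r x₀ = Fintype.card X := by
      unfold bsize
      rw [Finset.filter_true_of_mem (fun x _ => hall x), Finset.card_univ]
    omega
  have hc : 0 < c := (hbpos x₀).trans_le (hb x₀)
  refine ⟨le_antisymm ?_ ?_, ?_⟩
  · exact iSup₂_le fun P hP => part1_upper r hr c hb P hP
  · have := part1_lower r x₁ (hbpos x₁)
    rwa [hother x₁ hx₁] at this
  · intro ν T hν h1 hsub
    exact part2 ⟨r, hr⟩ c hc x₀ hother ν T hν h1 hsub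
end
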